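/- arXiv:2501.17701 — 12 statements merged into one kernel-verified Lean document; each statement's English description precedes it below -/
import Mathlib

section
/- Let b ≥ 1, r ≥ 2 and T > 0. The ski-rental threshold algorithm A_T is r-robust (i.e. A_T(x)/min(x,b) ≤ r for every horizon x > 0) if and only if b/(r−1) ≤ T ≤ b·(r−1). -/
/-- Cost of the continuous ski-rental threshold algorithm with threshold `T` and
buying cost `b` on horizon `x`: rent until `T`, then buy. -/
noncomputable def skiCost (b T x : ℝ) : ℝ := if x < T then x else T + b

/-- The ski-rental threshold algorithm `A_T` is `r`-robust iff
`b/(r-1) ≤ T ≤ b·(r-1)`. -/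
theorem ski_rental_robust_iff (b r T : ℝ) (hb : 1 ≤ b) (hr : 2 ≤ r) (hT : 0 < T) :
    (∀ x : ℝ, 0 < x → skiCost b T x / min x b ≤ r) ↔
      b / (r - 1) ≤ T ∧ T ≤ b * (r - 1) := by
  have robust_at (x : ℝ) (hx : 0 < x) :
      skiCost b T x / min x b ≤ r ↔ skiCost b T x ≤ r * x ∧ skiCost b T x ≤ r * b := by
    rw [div_le_iff₀ (lt_min hx (by linarith)), mul_min_of_nonneg _ _ (by linarith), le_min_iff]
  rw [div_le_iff₀ (by linarith)]
  constructor
  · intro h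
    obtain ⟨h₁, h₂⟩ := (robust_at T hT).1 (h T hT)
    simp only [skiCost, lt_irrefl, if_false] at h₁ h₂
    constructor <;> linarith
  · rintro ⟨h₁, h₂⟩ x hx
    rw [robust_at x hx]
    unfold skiCost
    split_ifs with hxT
    · constructor <;> nlinarith
    · constructor <;> nlinarith
end

section
/- Let b ≥ 1, r ≥ 2, and set m = min{ b·r/(r−1), b·(r−1) }. For every horizon x > 0, the smallest performance ratio achievable by an r-robust threshold algorithm, namely inf over T ∈ [b/(r−1), b·(r−1)] of A_T(x)/min(x,b), equals: 1 if x < b; x/b if b ≤ x < m; and r/(r−1) if x ≥ m. -/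
/-- The performance ratio of the ideal `r`-robust ski-rental algorithm: for every
horizon `x > 0`, the smallest performance ratio achievable by an `r`-robust
threshold algorithm is `1` for `x < b`, `x/b` for `b ≤ x < m`, and `r/(r-1)` for
`x ≥ m`, where `m = min (b·r/(r-1)) (b·(r-1))`. -/
theorem ski_rental_ideal_ratio (b r x : ℝ) (hb : 1 ≤ b) (hr : 2 ≤ r) (hx : 0 < x) :
    sInf ((fun T => skiCost b T x / min x b) '' Set.Icc (b / (r - 1)) (b * (r - 1))) =
      if x < b then 1
      else if x < min (b * r / (r - 1)) (b * (r - 1)) then x / b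
      else r / (r - 1) := by
  have hr1 : 0 < r - 1 := by linarith
  have hb0 : 0 < b := by linarith
  have hlow : b / (r - 1) ≤ b := div_le_self hb0.le (by linarith)
  have hup : b ≤ b * (r - 1) := le_mul_of_one_le_right hb0.le (by linarith)
  have hsum : b / (r - 1) + b = b * r / (r - 1) := by field_simp; ring
  have hratio : b * r / (r - 1) / b = r / (r - 1) := by field_simp
  apply IsLeast.csInf_eq
  split_ifs with h1 h2
  · refine ⟨⟨b * (r - 1), ⟨hlow.trans hup, le_rfl⟩, ?_⟩, ?_⟩
    · simp only [skiCost, if_pos (h1.trans_le hup), min_eq_left h1.le]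
      exact div_self hx.ne'
    · rintro _ ⟨T, ⟨hT, -⟩, rfl⟩
      have hT0 : 0 < T := (div_pos hb0 hr1).trans_le hT
      simp only [skiCost, min_eq_left h1.le]
      rw [one_le_div hx]
      split_ifs <;> linarith
  · rw [not_lt] at h1
    obtain ⟨h3, h4⟩ := lt_min_iff.1 h2
    refine ⟨⟨b * (r - 1), ⟨hlow.trans hup, le_rfl⟩, ?_⟩, ?_⟩
    · simp only [skiCost, if_pos h4, min_eq_right h1]
    · rintro _ ⟨T, ⟨hT, -⟩, rfl⟩
      simp only [skiCost, min_eq_right h1]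
      apply div_le_div_of_nonneg_right _ hb0.le
      split_ifs <;> linarith
  · rw [not_lt] at h1 h2
    refine ⟨⟨b / (r - 1), ⟨le_rfl, hlow.trans hup⟩, ?_⟩, ?_⟩
    · simp only [skiCost, if_neg (hlow.trans h1).not_gt, min_eq_right h1, hsum, hratio]
    · rintro _ ⟨T, ⟨hT, hT'⟩, rfl⟩
      simp only [skiCost, min_eq_right h1]
      rw [← hratio]
      apply div_le_div_of_nonneg_right _ hb0.le
      rcases min_le_iff.1 h2 with h | h <;> split_ifs <;> linarith
end

section
/- Let b ≥ 1, T > 0, α ∈ [0,1), and let μ : [0,u] → [0,∞) be a probability density (∫₀ᵘ μ = 1, u > 0) whose cumulative distribution function M(t) = ∫₀ᵗ μ(z) dz is continuous and strictly increasing on [0,u]. Let t* ∈ [0,u] satisfy M(t*) = α, let q_T = ∫_T^u μ(z) dz, and assume M(T) ≥ α (equivalently t* ≤ T). Then the cost conditional value-at-risk of the ski-rental cost A_T(x) under x ∼ μ, defined as inf over t ∈ ℝ of { t + (1/(1−α))·∫₀ᵘ max(A_T(z) − t, 0)·μ(z) dz }, equals min{ (1/(1−α))·( ∫_{t*}^{T}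 z·μ(z) dz + (T+b)·q_T ), T + b·q_T/(1−α), T + b }. -/
open MeasureTheory intervalIntegral

theorem measurable_skiCost (b T : ℝ) : Measurable (skiCost b T) :=
  Measurable.ite measurableSet_Iio measurable_id measurable_const

theorem skiCost_of_lt {b T z : ℝ} (hz : z < T) : skiCost b T z = z := if_pos hz

theorem skiCost_of_le {b T z : ℝ} (hz : T ≤ z) : skiCost b T z = T + b := if_neg hz.not_gt

theorem le_skiCost {b T s z : ℝ} (hb : 0 ≤ b) (hs : s ≤ T) (hz : s ≤ z) : s ≤ skiCost b T z := by
  unfold skiCost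
  split_ifs <;> linarith

/-- The excess cost over a level `t` is integrable against an integrable density. -/
theorem integrable_max_skiCost_sub_mul {b T : ℝ} (hb : 0 ≤ b) (hT : 0 ≤ T) {μ : ℝ → ℝ}
    (hμ : Integrable μ) (t : ℝ) :
    Integrable fun z => max (skiCost b T z - t) 0 * μ z := by
  refine hμ.bdd_mul (c := T + b + |t|)
    (((measurable_skiCost b T).sub_const t).max measurable_const).aestronglyMeasurable ?_
  refine Filter.Eventually.of_forall fun z => ?_
  have ht := neg_abs_le t
  have h0 := abs_nonneg t
  rw [Real.norm_of_nonneg (le_max_right _ _)]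
  refine max_le ?_ (by linarith)
  unfold skiCost
  split_ifs <;> linarith

/-- The expected excess cost over a level `s ≤ T`, in closed form. -/
theorem integral_max_skiCost_sub_mul {b T s u : ℝ} (hb : 0 ≤ b) (hT : 0 ≤ T) {μ : ℝ → ℝ}
    (hμ : Integrable μ) (hμ_zero : ∀ z, u < z → μ z = 0) (hs : 0 ≤ s) (hsT : s ≤ T) :
    ∫ z in (0:ℝ)..u, max (skiCost b T z - s) 0 * μ z =
      (∫ z in s..T, z * μ z) + (T + b) * (∫ z in T..u, μ z) - s * ∫ z in s..u, μ z := by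
  have hG := integrable_max_skiCost_sub_mul hb hT hμ s
  have h1 : ∫ z in (0:ℝ)..s, max (skiCost b T z - s) 0 * μ z = 0 := by
    rw [integral_congr_Ioo_of_le (g := fun _ => (0:ℝ)) hs]
    · simp
    · intro z hz
      have hA := skiCost_of_lt (b := b) (hz.2.trans_le hsT)
      simp only
      rw [hA, max_eq_right (by linarith [hz.2]), zero_mul]
  have h2 : ∫ z in s..T, max (skiCost b T z - s) 0 * μ z =
      (∫ z in s..T, z * μ z) - s * ∫ z in s..T, μ z := by
    rw [integral_congr_Ioo_of_le (g := fun z => z * μ z - s * μ z) hsT]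
    · rw [intervalIntegral.integral_sub _ (hμ.intervalIntegrable.const_mul s),
        intervalIntegral.integral_const_mul]
      exact hμ.intervalIntegrable.continuousOn_mul continuousOn_id
    · intro z hz
      simp only
      rw [skiCost_of_lt hz.2, max_eq_left (by linarith [hz.1])]
      ring
  have h3 : ∫ z in T..u, max (skiCost b T z - s) 0 * μ z =
      (T + b - s) * ∫ z in T..u, μ z := by
    rw [← intervalIntegral.integral_const_mul]
    refine integral_congr_uIoo fun z hz => ?_
    rcases le_total T u with h | h
    · rw [Set.uIoo_of_le h] at hz
      rw [skiCost_of_le hz.1.le, max_eq_left (by linarith)]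
    · rw [Set.uIoo_of_ge h] at hz
      rw [hμ_zero z hz.1, mul_zero, mul_zero]
  have h4 : (∫ z in s..T, μ z) + ∫ z in T..u, μ z = ∫ z in s..u, μ z :=
    integral_add_adjacent_intervals hμ.intervalIntegrable hμ.intervalIntegrable
  rw [← integral_add_adjacent_intervals (b := s) hG.intervalIntegrable hG.intervalIntegrable,
    ← integral_add_adjacent_intervals (a := s) (b := T) hG.intervalIntegrable
      hG.intervalIntegrable, h1, h2, h3, ← h4]
  ring

/-- Subgradient inequality for the expected excess cost at a level `s ≤ T`. -/
theorem integral_max_skiCost_sub_mul_add_le {b T s u : ℝ} (hb : 0 ≤ b) (hT : 0 ≤ T) {μ : ℝ → ℝ}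
    (hμ : Integrable μ) (hμ_nonneg : ∀ z, 0 ≤ μ z) (hs : 0 ≤ s) (hsT : s ≤ T) (hsu : s ≤ u)
    (t : ℝ) :
    (∫ z in (0:ℝ)..u, max (skiCost b T z - s) 0 * μ z) + (s - t) * (∫ z in s..u, μ z) ≤
      ∫ z in (0:ℝ)..u, max (skiCost b T z - t) 0 * μ z := by
  have hG := integrable_max_skiCost_sub_mul hb hT hμ
  have h1 : ∫ z in (0:ℝ)..s, max (skiCost b T z - s) 0 * μ z ≤
      ∫ z in (0:ℝ)..s, max (skiCost b T z - t) 0 * μ z := by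
    refine integral_mono_on_of_le_Ioo hs (hG s).intervalIntegrable (hG t).intervalIntegrable ?_
    intro z hz
    refine mul_le_mul_of_nonneg_right ?_ (hμ_nonneg z)
    rw [skiCost_of_lt (hz.2.trans_le hsT), max_eq_right (by linarith [hz.2])]
    exact le_max_right _ _
  have h2 : (∫ z in s..u, max (skiCost b T z - s) 0 * μ z) + (s - t) * (∫ z in s..u, μ z) ≤
      ∫ z in s..u, max (skiCost b T z - t) 0 * μ z := by
    rw [← intervalIntegral.integral_const_mul, ← intervalIntegral.integral_add
      (hG s).intervalIntegrable (hμ.intervalIntegrable.const_mul _)]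
    refine integral_mono_on hsu ((hG s).intervalIntegrable.add
      (hμ.intervalIntegrable.const_mul _)) (hG t).intervalIntegrable fun z hz => ?_
    rw [← add_mul]
    refine mul_le_mul_of_nonneg_right ?_ (hμ_nonneg z)
    rw [max_eq_left (sub_nonneg.2 (le_skiCost hb hsT hz.1))]
    exact (by ring : skiCost b T z - s + (s - t) = skiCost b T z - t).trans_le (le_max_left _ _)
  rw [← integral_add_adjacent_intervals (b := s) (hG s).intervalIntegrable
      (hG s).intervalIntegrable,
    ← integral_add_adjacent_intervals (b := s) (hG t).intervalIntegrable
      (hG t).intervalIntegrable]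
  linarith

/-- The cost-version conditional value-at-risk of the ski-rental cost `A_T(x)`
under a density `μ` on `[0,u]`: it equals the minimum of the three candidate
values of the paper. Here `t*` is the `α`-quantile of `μ` (i.e. `M(t*) = α`),
and `q_T = ∫_T^u μ`. -/
theorem ski_rental_cvar (b T u α tstar : ℝ) (μ : ℝ → ℝ)
    (hb : 1 ≤ b) (hT : 0 < T) (hα : α ∈ Set.Ico (0:ℝ) 1) (hu : 0 < u)
    (hμ_nonneg : ∀ z ∈ Set.Icc (0:ℝ) u, 0 ≤ μ z)
    (hμ_zero : ∀ z, z ∉ Set.Icc (0:ℝ) u → μ z = 0)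
    (hμ_int : IntervalIntegrable μ volume 0 u)
    (hμ_one : (∫ z in (0:ℝ)..u, μ z) = 1)
    (hM_cont : ContinuousOn (fun t => ∫ z in (0:ℝ)..t, μ z) (Set.Icc 0 u))
    (hM_mono : StrictMonoOn (fun t => ∫ z in (0:ℝ)..t, μ z) (Set.Icc 0 u))
    (htstar : tstar ∈ Set.Icc (0:ℝ) u)
    (hts : (∫ z in (0:ℝ)..tstar, μ z) = α)
    (hMT : α ≤ ∫ z in (0:ℝ)..T, μ z) :
    (⨅ t : ℝ, (t + (1 / (1 - α)) * ∫ z in (0:ℝ)..u, max (skiCost b T z - t) 0 * μ z)) =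
      min ((1 / (1 - α)) * ((∫ z in tstar..T, z * μ z) + (T + b) * ∫ z in T..u, μ z))
        (min (T + b * (∫ z in T..u, μ z) / (1 - α)) (T + b)) := by
  have hb0 : 0 ≤ b := by linarith
  have hα1 : 0 < 1 - α := by linarith [hα.2]
  have hint : Integrable μ := by
    refine IntegrableOn.integrable_of_forall_notMem_eq_zero (s := Set.Icc 0 u) ?_ hμ_zero
    exact (intervalIntegrable_iff_integrableOn_Icc_of_le hu.le).1 hμ_int
  have hnonneg : ∀ z, 0 ≤ μ z := fun z => by
    by_cases hz : z ∈ Set.Icc (0:ℝ) u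
    · exact hμ_nonneg z hz
    · exact (hμ_zero z hz).ge
  have hsT : tstar ≤ T := by
    rcases le_total u T with h | h
    · exact htstar.2.trans h
    · exact (hM_mono.le_iff_le htstar ⟨hT.le, h⟩).1 (hts.trans_le hMT)
  have hsplit : ∀ c, (∫ z in (0:ℝ)..c, μ z) + ∫ z in c..u, μ z = 1 := fun c =>
    (integral_add_adjacent_intervals hint.intervalIntegrable hint.intervalIntegrable).trans hμ_one
  have htail : ∫ z in tstar..u, μ z = 1 - α := by linarith [hsplit tstar]
  have hq : ∫ z in T..u, μ z ≤ 1 - α := by linarith [hsplit T]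
  have hmid : (∫ z in tstar..T, μ z) = 1 - α - ∫ z in T..u, μ z := by
    rw [← htail, ← integral_add_adjacent_intervals (a := tstar) (b := T) (c := u)
      hint.intervalIntegrable hint.intervalIntegrable]
    ring
  have hmidT : ∫ z in tstar..T, z * μ z ≤ T * (1 - α - ∫ z in T..u, μ z) := by
    rw [← hmid, ← intervalIntegral.integral_const_mul]
    exact integral_mono_on hsT (hint.intervalIntegrable.continuousOn_mul continuousOn_id)
      (hint.intervalIntegrable.const_mul T)
      fun z hz => mul_le_mul_of_nonneg_right hz.2 (hnonneg z)
  have hval := integral_max_skiCost_sub_mul hb0 hT.le hint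
    (fun z hz => hμ_zero z fun h => hz.not_ge h.2) htstar.1 hsT
  have hsub := integral_max_skiCost_sub_mul_add_le hb0 hT.le hint hnonneg htstar.1 hsT htstar.2
  rw [htail] at hval
  rw [hval, htail] at hsub
  generalize (∫ z in T..u, μ z) = q at *
  generalize (∫ z in tstar..T, z * μ z) = m at *
  have h12 : 1 / (1 - α) * (m + (T + b) * q) ≤ T + b * q / (1 - α) := by
    rw [← sub_nonneg, show T + b * q / (1 - α) - 1 / (1 - α) * (m + (T + b) * q) =
      (T * (1 - α - q) - m) / (1 - α) by field_simp; ring]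
    exact div_nonneg (sub_nonneg.2 hmidT) hα1.le
  have h23 : T + b * q / (1 - α) ≤ T + b := by
    rw [mul_div_assoc]
    exact add_le_add_right (mul_le_of_le_one_right hb0 ((div_le_one hα1).2 hq)) T
  rw [min_eq_left h23, min_eq_left h12]
  refine IsLeast.csInf_eq ⟨⟨tstar, ?_⟩, ?_⟩
  · simp only [hval]
    field_simp
    ring
  · rintro _ ⟨t, rfl⟩
    calc 1 / (1 - α) * (m + (T + b) * q)
        = t + 1 / (1 - α) * (m + (T + b) * q - tstar * (1 - α) + (tstar - t) * (1 - α)) := by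
          field_simp
          ring
      _ ≤ _ := by
          have := hsub t
          dsimp only
          gcongr
end

section
/- Let M > 1, 1 ≤ T ≤ M, and 1 ≤ x ≤ M. The supremum, over all finite nonempty sequences σ of prices in [1, M] whose maximum price equals x, of the performance ratio x/A_T(σ), equals x/T if x ≥ T and equals x if x < T; moreover this supremum is attained by some sequence with maximum price x. -/
/-- Profit of the one-max-search threshold algorithm `A_T` on a sequence of
prices: it accepts the first price that is at least `T`, and earns `1` if no
price is at least `T`. -/
noncomputable def omsProfit (T : ℝ) : List ℝ → ℝ
  | [] => 1
  | p :: s => if T ≤ p then p else omsProfit T s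

theorem le_omsProfit_of_mem {T x : ℝ} {σ : List ℝ} (hx : x ∈ σ) (hT : T ≤ x) :
    T ≤ omsProfit T σ := by
  induction σ with
  | nil => simp at hx
  | cons p s ih =>
    by_cases hp : T ≤ p
    · simpa only [omsProfit, if_pos hp] using hp
    · rw [omsProfit, if_neg hp]
      rcases List.mem_cons.mp hx with rfl | hs
      · exact absurd hT hp
      · exact ih hs

theorem omsProfit_eq_one {T : ℝ} {σ : List ℝ} (h : ∀ p ∈ σ, p < T) :
    omsProfit T σ = 1 := by
  induction σ with
  | nil => rfl
  | cons p s ih =>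
    rw [List.forall_mem_cons] at h
    rw [omsProfit, if_neg h.1.not_ge, ih h.2]

/-- For one-max search with prices in `[1, M]`, threshold `T ∈ [1, M]` and target
maximum price `x ∈ [1, M]`, the supremum over all finite nonempty sequences with
maximum price `x` of the performance ratio `x / A_T(σ)` equals `x/T` if `x ≥ T`
and `x` otherwise; moreover it is attained. -/
theorem oms_worst_case_ratio (M T x : ℝ) (hM : 1 < M)
    (hT : T ∈ Set.Icc 1 M) (hx : x ∈ Set.Icc 1 M) :
    IsGreatest
      {u : ℝ | ∃ σ : List ℝ, σ ≠ [] ∧ (∀ p ∈ σ, p ∈ Set.Icc 1 M) ∧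
        x ∈ σ ∧ (∀ p ∈ σ, p ≤ x) ∧ u = x / omsProfit T σ}
      (if T ≤ x then x / T else x) := by
  have hx0 : 0 ≤ x := zero_le_one.trans hx.1
  have hT0 : 0 < T := zero_lt_one.trans_le hT.1
  split_ifs with h
  · refine ⟨⟨[T, x], by simp, by simpa using ⟨hT, hx⟩, by simp, by simpa using h, ?_⟩, ?_⟩
    · simp [omsProfit]
    · rintro u ⟨σ, -, -, hmem, -, rfl⟩
      exact div_le_div_of_nonneg_left hx0 hT0 (le_omsProfit_of_mem hmem h)
  · refine ⟨⟨[x], by simp, by simpa using hx, by simp, by simp, ?_⟩, ?_⟩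
    · simp [omsProfit, h]
    · rintro u ⟨σ, -, -, -, hmax, rfl⟩
      rw [omsProfit_eq_one fun p hp => (hmax p hp).trans_lt (not_le.mp h), div_one]
end

section
/- Let M > 1, r ≥ √M, and 1 ≤ T ≤ M. Then the threshold algorithm A_T is r-robust, i.e. x_σ/A_T(σ) ≤ r for every finite nonempty sequence σ of prices in [1, M], if and only if M/r ≤ T ≤ r. -/
/-- Either every price is below `T` and the profit is `1`, or the profit is at least `T`. -/
theorem omsProfit_eq_one_or_le (T : ℝ) (σ : List ℝ) :
    (omsProfit T σ = 1 ∧ ∀ p ∈ σ, p < T) ∨ T ≤ omsProfit T σ := by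
  induction σ with
  | nil => simp [omsProfit]
  | cons p s ih =>
    by_cases h : T ≤ p
    · simp [omsProfit, h]
    · simpa [omsProfit, h, not_le.mp h] using ih

/-- For one-max search with prices in `[1, M]` and `r ≥ √M`, the threshold
algorithm `A_T` (with `T ∈ [1, M]`) is `r`-robust — i.e. `x_σ / A_T(σ) ≤ r` for
every finite nonempty sequence `σ` of prices in `[1, M]` with maximum `x_σ` —
if and only if `M/r ≤ T ≤ r`. -/
theorem oms_robust_iff (M r T : ℝ) (hM : 1 < M) (hr : Real.sqrt M ≤ r)
    (hT : T ∈ Set.Icc 1 M) :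
    (∀ σ : List ℝ, σ ≠ [] → (∀ p ∈ σ, p ∈ Set.Icc 1 M) →
      ∀ x ∈ σ, (∀ p ∈ σ, p ≤ x) → x / omsProfit T σ ≤ r) ↔
    (M / r ≤ T ∧ T ≤ r) := by
  obtain ⟨hT1, hTM⟩ := hT
  have hr1 : 1 < r := lt_of_lt_of_le (Real.lt_sqrt_of_sq_lt (by simpa using hM)) hr
  have hr0 : 0 < r := one_pos.trans hr1
  have hT0 : 0 < T := one_pos.trans_le hT1
  constructor
  · intro h
    constructor
    · have h1 := h [T, M] (by simp) (by simp [hT1, hTM, hM.le]) M (by simp) (by simp [hTM])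
      simp only [omsProfit, le_refl, if_true] at h1
      exact (div_le_comm₀ hT0 hr0).mp h1
    · by_contra! hlt
      have hmid : ¬ T ≤ (r + T) / 2 := by linarith
      have h1 := h [(r + T) / 2] (by simp)
        (by simpa using ⟨by linarith, by linarith⟩) ((r + T) / 2) (by simp) (by simp)
      simp only [omsProfit, if_neg hmid, div_one] at h1
      linarith
  · rintro ⟨hMr, hTr⟩ σ - hσ x hx -
    rcases omsProfit_eq_one_or_le T σ with ⟨h1, hlt⟩ | hle
    · rw [h1, div_one]
      exact (hlt x hx).le.trans hTr
    · calc x / omsProfit T σ ≤ M / T := by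
            gcongr
            exact (hσ x hx).2
        _ ≤ r := (div_le_comm₀ hr0 hT0).mp hMr
end

section
/- Let α ∈ [0,1), let a ≤ b be real numbers, and let q ∈ [0,1]. For the two-point random variable X with P[X = a] = q and P[X = b] = 1 − q, the profit-version conditional value-at-risk satisfies CVaR_α(X) = sup_{t ∈ ℝ} { t − (1/(1−α))·( q·max(t − a, 0) + (1−q)·max(t − b, 0) ) } = max{ a, ( a·q + b·(1−α−q) )/(1−α) }. -/
/-- Profit-version conditional value-at-risk of a two-point random variable
taking value `a` with probability `q` and value `b ≥ a` with probability `1-q`: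
it equals `max a ((a·q + b·(1−α−q))/(1−α))`. -/
theorem cvar_two_point (α a b q : ℝ) (hα : α ∈ Set.Ico (0:ℝ) 1) (hab : a ≤ b)
    (hq : q ∈ Set.Icc (0:ℝ) 1) :
    (⨆ t : ℝ, (t - (1 / (1 - α)) * (q * max (t - a) 0 + (1 - q) * max (t - b) 0))) =
      max a ((a * q + b * (1 - α - q)) / (1 - α)) := by
  obtain ⟨hα0, hα1⟩ := hα
  have hpos : 0 < 1 - α := by linarith
  have hc : 1 ≤ 1 / (1 - α) := by
    rw [le_div_iff₀ hpos]; linarith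
  have hval : (a * q + b * (1 - α - q)) / (1 - α) = b - 1 / (1 - α) * (q * (b - a)) := by
    field_simp; ring
  rw [hval]
  generalize 1 / (1 - α) = c at hc
  have hle : ∀ t : ℝ, t - c * (q * max (t - a) 0 + (1 - q) * max (t - b) 0) ≤
      max a (b - c * (q * (b - a))) := by
    intro t
    rcases le_total t a with hta | hat
    · rw [max_eq_right (by linarith : t - a ≤ 0), max_eq_right (by linarith : t - b ≤ 0)]
      exact le_max_of_le_left (by linarith)
    rw [max_eq_left (by linarith : 0 ≤ t - a)]
    rcases le_total t b with htb | hbt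
    · rw [max_eq_right (by linarith : t - b ≤ 0)]
      rcases le_total 1 (c * q) with h | h
      · exact le_max_of_le_left (by nlinarith)
      · exact le_max_of_le_right (by nlinarith)
    · rw [max_eq_left (by linarith : 0 ≤ t - b)]
      exact le_max_of_le_right (by nlinarith)
  have hbdd : BddAbove (Set.range fun t : ℝ =>
      t - c * (q * max (t - a) 0 + (1 - q) * max (t - b) 0)) :=
    ⟨_, Set.forall_mem_range.2 hle⟩
  refine le_antisymm (ciSup_le hle) (max_le ?_ ?_)
  · refine le_ciSup_of_le hbdd a ?_
    simp [hab]
  · refine le_ciSup_of_le hbdd b ?_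
    simp [hab]
end

section
/- Let λ > 0, y > 0 and 0 < δ ≤ 1/3, and let κ = ⌊log₂((1−δ)y/λ)⌋. Then for every T ∈ [(1−δ)y, (1+δ)y], the length ℓ_λ(T) of the largest contract of the doubling schedule X_λ completed by time T takes one of only two values: ℓ_λ(T) = λ·2^{κ−1} or ℓ_λ(T) = λ·2^{κ}; specifically, ℓ_λ(T) = λ·2^{κ−1} exactly when T < λ·2^{κ+1}. -/
/-- Length of the largest contract of the doubling schedule `X_λ` completed by
time `t`: `ℓ_λ(t) = λ·2^(⌊log₂(t/λ)⌋ − 1)`. -/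
noncomputable def contractLen (lam t : ℝ) : ℝ :=
  lam * (2:ℝ) ^ (⌊Real.logb 2 (t / lam)⌋ - 1)

/-- An integer power of two exceeds `x > 0` iff its exponent exceeds `⌊log₂ x⌋`. -/
theorem floor_logb_two_lt_iff {x : ℝ} (hx : 0 < x) (k : ℤ) :
    ⌊Real.logb 2 x⌋ < k ↔ x < (2:ℝ) ^ k := by
  rw [Int.floor_lt, Real.logb_lt_iff_lt_rpow one_lt_two hx, Real.rpow_intCast]

/-- Contract lengths of the doubling schedule determine their exponents. -/
theorem mul_two_zpow_inj {a : ℝ} (ha : a ≠ 0) (m n : ℤ) :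
    a * (2:ℝ) ^ m = a * (2:ℝ) ^ n ↔ m = n := by
  rw [mul_right_inj' ha, zpow_right_inj₀ two_pos (by norm_num)]

/-- For `0 < δ ≤ 1/3` and `κ = ⌊log₂((1−δ)y/λ)⌋`, on the prediction range
`[(1−δ)y, (1+δ)y]` the completed contract length `ℓ_λ(T)` takes only the two
values `λ·2^(κ−1)` and `λ·2^κ`, and equals `λ·2^(κ−1)` exactly when
`T < λ·2^(κ+1)`. -/
theorem contract_two_lengths (lam y δ : ℝ) (hlam : 0 < lam) (hy : 0 < y)
    (hδ1 : 0 < δ) (hδ2 : δ ≤ 1/3) :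
    ∀ T ∈ Set.Icc ((1 - δ) * y) ((1 + δ) * y),
      (contractLen lam T = lam * (2:ℝ) ^ (⌊Real.logb 2 ((1 - δ) * y / lam)⌋ - 1) ∨
        contractLen lam T = lam * (2:ℝ) ^ ⌊Real.logb 2 ((1 - δ) * y / lam)⌋) ∧
      (contractLen lam T = lam * (2:ℝ) ^ (⌊Real.logb 2 ((1 - δ) * y / lam)⌋ - 1) ↔
        T < lam * (2:ℝ) ^ (⌊Real.logb 2 ((1 - δ) * y / lam)⌋ + 1)) := by
  rintro T ⟨hT1, hT2⟩
  have hS : 0 < (1 - δ) * y := mul_pos (by linarith) hy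
  have hx : 0 < (1 - δ) * y / lam := div_pos hS hlam
  have hxt : (1 - δ) * y / lam ≤ T / lam := by gcongr
  have ht : 0 < T / lam := hx.trans_le hxt
  have hlt : T < lam * (2:ℝ) ^ (⌊Real.logb 2 ((1 - δ) * y / lam)⌋ + 1) ↔
      ⌊Real.logb 2 (T / lam)⌋ < ⌊Real.logb 2 ((1 - δ) * y / lam)⌋ + 1 := by
    rw [floor_logb_two_lt_iff ht, div_lt_iff₀' hlam]
  have hlow : ⌊Real.logb 2 ((1 - δ) * y / lam)⌋ ≤ ⌊Real.logb 2 (T / lam)⌋ :=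
    Int.floor_le_floor (Real.logb_le_logb_of_le one_lt_two hx hxt)
  have hup : ⌊Real.logb 2 (T / lam)⌋ < ⌊Real.logb 2 ((1 - δ) * y / lam)⌋ + 1 + 1 := by
    have hk := (floor_logb_two_lt_iff hx _).1 (lt_add_one _)
    have hT : T ≤ 2 * ((1 - δ) * y) := by nlinarith
    rw [floor_logb_two_lt_iff ht, zpow_add_one₀ two_ne_zero, div_lt_iff₀' hlam]
    rw [div_lt_iff₀' hlam] at hk
    linarith
  rw [hlt]
  simp only [contractLen, mul_two_zpow_inj hlam.ne']
  omega
end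

section
/- For every λ > 0 and every t > 0, the performance ratio of the doubling schedule X_λ satisfies 2 ≤ t/ℓ_λ(t) < 4, and the acceleration ratio of X_λ equals 4, i.e. sup over t > 0 of t/ℓ_λ(t) = 4. -/
theorem two_zpow_floor_logb_le {x : ℝ} (hx : 0 < x) : (2:ℝ) ^ ⌊Real.logb 2 x⌋ ≤ x := by
  rw [← Real.rpow_intCast, ← Real.le_logb_iff_rpow_le one_lt_two hx]
  exact Int.floor_le _

theorem lt_two_zpow_floor_logb_add_one {x : ℝ} (hx : 0 < x) :
    x < (2:ℝ) ^ (⌊Real.logb 2 x⌋ + 1) := by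
  rw [← Real.rpow_intCast, ← Real.logb_lt_iff_lt_rpow one_lt_two hx]
  push_cast
  exact Int.lt_floor_add_one _

theorem ratio_contractLen_bounds {lam t : ℝ} (hlam : 0 < lam) (ht : 0 < t) :
    2 ≤ t / contractLen lam t ∧ t / contractLen lam t < 4 := by
  have hx : 0 < t / lam := div_pos ht hlam
  have hlow := two_zpow_floor_logb_le hx
  have hupp := lt_two_zpow_floor_logb_add_one hx
  have hpow : (0:ℝ) < 2 ^ ⌊Real.logb 2 (t / lam)⌋ := by positivity
  have hratio : t / contractLen lam t = 2 * (t / lam) / 2 ^ ⌊Real.logb 2 (t / lam)⌋ := by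
    rw [contractLen, zpow_sub_one₀ two_ne_zero]
    generalize (2:ℝ) ^ ⌊Real.logb 2 (t / lam)⌋ = p at hpow
    field_simp
  rw [zpow_add_one₀ two_ne_zero] at hupp
  rw [hratio, le_div_iff₀ hpow, div_lt_iff₀ hpow]
  constructor <;> linarith

theorem ratio_contractLen_mul {lam y : ℝ} (hlam : 0 < lam) (hy : 1 ≤ y) (hy2 : y < 2) :
    lam * y / contractLen lam (lam * y) = 2 * y := by
  have hfloor : ⌊Real.logb 2 y⌋ = 0 := by
    rw [Int.floor_eq_zero_iff, Set.mem_Ico]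
    refine ⟨Real.logb_nonneg one_lt_two hy, ?_⟩
    rw [Real.logb_lt_iff_lt_rpow one_lt_two (by linarith)]
    simpa using hy2
  rw [contractLen, mul_div_cancel_left₀ _ hlam.ne', hfloor, zero_sub, zpow_neg_one]
  field_simp

/-- For every `λ > 0` and every interruption time `t > 0`, the performance ratio
of the doubling schedule satisfies `2 ≤ t/ℓ_λ(t) < 4`, and the acceleration
ratio of `X_λ`, i.e. the supremum of `t/ℓ_λ(t)` over `t > 0`, equals `4`. -/
theorem doubling_acceleration_ratio (lam : ℝ) (hlam : 0 < lam) :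
    (∀ t : ℝ, 0 < t →
      2 ≤ t / contractLen lam t ∧ t / contractLen lam t < 4) ∧
    sSup ((fun t => t / contractLen lam t) '' Set.Ioi (0:ℝ)) = 4 := by
  refine ⟨fun t ht => ratio_contractLen_bounds hlam ht, csSup_eq_of_forall_le_of_forall_lt_exists_gt
    (Set.nonempty_Ioi.image _) ?_ ?_⟩
  · rintro _ ⟨t, ht, rfl⟩
    exact (ratio_contractLen_bounds hlam ht).2.le
  · intro w hw
    obtain ⟨y, hwy, hy2⟩ := exists_between (max_lt (by linarith : w / 2 < 2) one_lt_two)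
    obtain ⟨hwy, hy⟩ := max_lt_iff.mp hwy
    refine ⟨_, ⟨lam * y, mul_pos hlam (by linarith), rfl⟩, ?_⟩
    simp only [ratio_contractLen_mul hlam hy.le hy2]
    linarith
end

section
/- Let y > 0 and δ ∈ (1/3, 1). Then for every λ ∈ [1, 2), the maximum distance of the doubling schedule X_λ from the ideal over the prediction range satisfies sup over T ∈ [(1−δ)y, (1+δ)y] of ( T/ℓ_λ(T) − 2 ) = 2. -/
theorem contractLen_eq_of_mem_Ico {lam t : ℝ} {n : ℤ}
    (h : t / lam ∈ Set.Ico ((2:ℝ) ^ n) ((2:ℝ) ^ (n + 1))) :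
    contractLen lam t = lam * (2:ℝ) ^ n / 2 := by
  have hpos : 0 < t / lam := lt_of_lt_of_le (by positivity) h.1
  have hfloor : ⌊Real.logb 2 (t / lam)⌋ = n := by
    rw [Int.floor_eq_iff]
    constructor
    · rw [Real.le_logb_iff_rpow_le one_lt_two hpos, Real.rpow_intCast]
      exact h.1
    · rw [Real.logb_lt_iff_lt_rpow one_lt_two hpos]
      exact_mod_cast h.2
  rw [contractLen, hfloor, zpow_sub_one₀ two_ne_zero]
  ring

theorem div_contractLen_lt_four {lam t : ℝ} (hl : 0 < lam) (ht : 0 < t) :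
    t / contractLen lam t < 4 := by
  obtain ⟨n, hn⟩ := exists_mem_Ico_zpow (div_pos ht hl) one_lt_two
  have h := hn.2
  rw [contractLen_eq_of_mem_Ico hn, div_lt_iff₀ (by positivity)]
  rw [div_lt_iff₀ hl, zpow_add_one₀ two_ne_zero] at h
  linarith

/-- For `δ ∈ (1/3, 1)`, every doubling schedule `X_λ` with `λ ∈ [1,2)` has
unit-weight maximum distance exactly `2` from the ideal over the prediction
range `[(1−δ)y, (1+δ)y]`. -/
theorem contract_max_distance_large_delta (y δ : ℝ) (hy : 0 < y)
    (hδ : δ ∈ Set.Ioo (1/3 : ℝ) 1) :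
    ∀ lam ∈ Set.Ico (1:ℝ) 2,
      sSup ((fun T => T / contractLen lam T - 2) ''
        Set.Icc ((1 - δ) * y) ((1 + δ) * y)) = 2 := by
  intro lam hlam
  have hl : 0 < lam := by linarith [hlam.1]
  obtain ⟨hδ1, hδ2⟩ := hδ
  have hlo : 0 < (1 - δ) * y := mul_pos (by linarith) hy
  have hlohi : 2 * ((1 - δ) * y) < (1 + δ) * y := by nlinarith
  apply csSup_eq_of_forall_le_of_forall_lt_exists_gt
  · exact (Set.nonempty_Icc.2 (by linarith)).image _
  · rintro _ ⟨t, ht, rfl⟩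
    have := div_contractLen_lt_four hl (hlo.trans_le ht.1)
    dsimp only
    linarith
  · intro w hw
    have hhi : 0 < (1 + δ) * y := by linarith
    obtain ⟨n, hn1, hn2⟩ := exists_mem_Ico_zpow (div_pos hhi hl) one_lt_two
    rw [le_div_iff₀ hl] at hn1
    rw [div_lt_iff₀ hl, zpow_add_one₀ two_ne_zero] at hn2
    have hp : (0:ℝ) < 2 ^ n := by positivity
    have hb : 0 < 2 ^ n * lam := mul_pos hp hl
    obtain ⟨t, ht1, ht2⟩ := exists_between (a₂ := 2 ^ n * lam)
      (max_lt (max_lt (show (1 - δ) * y < 2 ^ n * lam by linarith)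
        (show 2 ^ n * lam / 2 < 2 ^ n * lam by linarith))
        (show 2 ^ n * lam * ((w + 2) / 4) < 2 ^ n * lam by nlinarith))
    simp only [max_lt_iff] at ht1
    obtain ⟨⟨hlot, hhalf⟩, hwt⟩ := ht1
    refine ⟨_, ⟨t, ⟨hlot.le, by linarith⟩, rfl⟩, ?_⟩
    have hmem : t / lam ∈ Set.Ico ((2:ℝ) ^ (n - 1)) ((2:ℝ) ^ (n - 1 + 1)) := by
      constructor
      · rw [le_div_iff₀ hl, zpow_sub_one₀ two_ne_zero]
        linarith
      · rwa [div_lt_iff₀ hl, sub_add_cancel]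
    dsimp only
    rw [contractLen_eq_of_mem_Ico hmem, zpow_sub_one₀ two_ne_zero, lt_sub_iff_add_lt,
      lt_div_iff₀ (by positivity)]
    linarith
end

section
/- Let y > 0 and 0 < δ ≤ 1/3. (a) If λ* > 0 is such that (1−δ)y = λ*·2^{m} for some integer m (i.e. a contract of the doubling schedule X_{λ*} completes exactly at time (1−δ)y), then sup over T ∈ [(1−δ)y, (1+δ)y] of ( T/ℓ_{λ*}(T) − 2 ) = 4δ/(1−δ). (b) For every λ > 0, sup over T ∈ [(1−δ)y, (1+δ)y] of ( T/ℓ_λ(T) − 2 ) ≥ 4δ/(1−δ). Hence among doubling schedules, those completing a contract exactly at time (1−δ)y minimize the unit-weight maximum distance over the prediction range. -/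
theorem exists_int_mul_two_zpow_le_lt {lam t : ℝ} (hlam : 0 < lam) (ht : 0 < t) :
    ∃ n : ℤ, lam * (2:ℝ) ^ n ≤ t ∧ t < 2 * (lam * (2:ℝ) ^ n) := by
  obtain ⟨n, hn1, hn2⟩ := exists_mem_Ico_zpow (div_pos ht hlam) (one_lt_two (α := ℝ))
  refine ⟨n, ?_, ?_⟩
  · rwa [le_div_iff₀ hlam, mul_comm] at hn1
  · rw [div_lt_iff₀ hlam, zpow_add_one₀ two_ne_zero] at hn2
    linarith

theorem div_contractLen {lam t : ℝ} (hlam : 0 < lam) {n : ℤ}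
    (h1 : lam * (2:ℝ) ^ n ≤ t) (h2 : t < 2 * (lam * (2:ℝ) ^ n)) :
    t / contractLen lam t = 2 * t / (lam * (2:ℝ) ^ n) := by
  have hp : 0 < lam * (2:ℝ) ^ n := by positivity
  have ht : 0 < t / lam := div_pos (hp.trans_le h1) hlam
  have hfloor : ⌊Real.logb 2 (t / lam)⌋ = n := by
    rw [Int.floor_eq_iff]
    constructor
    · rw [Real.le_logb_iff_rpow_le one_lt_two ht, Real.rpow_intCast, le_div_iff₀ hlam]
      linarith
    · rw [Real.logb_lt_iff_lt_rpow one_lt_two ht, Real.rpow_add_one two_ne_zero,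
        Real.rpow_intCast, div_lt_iff₀ hlam]
      linarith
  rw [contractLen, hfloor, zpow_sub_one₀ two_ne_zero]
  field_simp

theorem div_contractLen_le_four {lam t : ℝ} (hlam : 0 < lam) (ht : 0 < t) :
    t / contractLen lam t ≤ 4 := by
  obtain ⟨n, h1, h2⟩ := exists_int_mul_two_zpow_le_lt hlam ht
  rw [div_contractLen hlam h1 h2, div_le_iff₀ (by positivity)]
  linarith

theorem bddAbove_contract_distance {lam a b : ℝ} (hlam : 0 < lam) (ha : 0 < a) :
    BddAbove ((fun T => T / contractLen lam T - 2) '' Set.Icc a b) := by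
  refine ⟨2, ?_⟩
  rintro _ ⟨T, hT, rfl⟩
  have := div_contractLen_le_four hlam (ha.trans_le hT.1)
  dsimp only
  linarith

theorem le_sSup_contract_distance {lam a b : ℝ} (hlam : 0 < lam) (ha : 0 < a)
    (hab : a ≤ b) (hb : b ≤ 2 * a) :
    2 * b / a - 2 ≤ sSup ((fun T => T / contractLen lam T - 2) '' Set.Icc a b) := by
  have hbdd := bddAbove_contract_distance (b := b) hlam ha
  obtain ⟨n, h1, h2⟩ := exists_int_mul_two_zpow_le_lt hlam (ha.trans_le hab)
  have hp : 0 < lam * (2:ℝ) ^ n := by positivity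
  rcases le_or_gt (lam * (2:ℝ) ^ n) a with hpa | hpa
  · refine le_trans ?_ (le_csSup hbdd ⟨b, ⟨hab, le_rfl⟩, rfl⟩)
    dsimp only
    rw [div_contractLen hlam h1 h2]
    have := ha.trans_le hab
    gcongr
  · refine le_of_forall_lt_imp_le_of_dense fun c hc => ?_
    set p := lam * (2:ℝ) ^ n with hpdef
    have hc4 : c + 2 < 4 := by
      have : 2 * b / a ≤ 4 := by rw [div_le_iff₀ ha]; linarith
      linarith
    have hTp : max a ((c + 2) * p / 4) < p := max_lt hpa (by nlinarith)
    have hprev : lam * (2:ℝ) ^ (n - 1) = p / 2 := by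
      rw [zpow_sub_one₀ two_ne_zero, hpdef]; ring
    have haT := le_max_left a ((c + 2) * p / 4)
    refine le_trans ?_ (le_csSup hbdd ⟨max a ((c + 2) * p / 4), ⟨haT, by linarith⟩, rfl⟩)
    dsimp only
    rw [div_contractLen hlam (n := n - 1) (by rw [hprev]; linarith) (by rw [hprev]; linarith),
      hprev, le_sub_iff_add_le, le_div_iff₀ (by positivity)]
    linarith [le_max_right a ((c + 2) * p / 4)]

theorem sSup_contract_distance_le {lam a b : ℝ} (hlam : 0 < lam) (ha : 0 < a)
    (hab : a ≤ b) (hb : b ≤ 2 * a) {m : ℤ} (hm : a = lam * (2:ℝ) ^ m) :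
    sSup ((fun T => T / contractLen lam T - 2) '' Set.Icc a b) ≤ 2 * b / a - 2 := by
  refine csSup_le ((Set.nonempty_Icc.2 hab).image _) ?_
  rintro _ ⟨T, ⟨haT, hTb⟩, rfl⟩
  dsimp only
  rcases lt_or_ge T (2 * a) with hT | hT
  · rw [div_contractLen hlam (n := m) (hm ▸ haT) (hm ▸ hT), ← hm]
    gcongr
  · have hba : b = 2 * a := by linarith
    have h4 : 2 * b / a = 4 := by rw [hba]; field_simp; norm_num
    linarith [div_contractLen_le_four hlam (ha.trans_le haT)]

/-- For `0 < δ ≤ 1/3`: (a) any doubling schedule completing a contract exactly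
at time `(1−δ)y` has unit-weight maximum distance `4δ/(1−δ)` over the
prediction range; (b) every doubling schedule has unit-weight maximum distance
at least `4δ/(1−δ)`. Hence such schedules minimize the maximum distance. -/
theorem contract_max_distance_opt (y δ : ℝ) (hy : 0 < y)
    (hδ1 : 0 < δ) (hδ2 : δ ≤ 1/3) :
    (∀ lam : ℝ, 0 < lam → (∃ m : ℤ, (1 - δ) * y = lam * (2:ℝ) ^ m) →
      sSup ((fun T => T / contractLen lam T - 2) ''
        Set.Icc ((1 - δ) * y) ((1 + δ) * y)) = 4 * δ / (1 - δ)) ∧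
    (∀ lam : ℝ, 0 < lam →
      4 * δ / (1 - δ) ≤
        sSup ((fun T => T / contractLen lam T - 2) ''
          Set.Icc ((1 - δ) * y) ((1 + δ) * y))) := by
  have ha : 0 < (1 - δ) * y := mul_pos (by linarith) hy
  have hab : (1 - δ) * y ≤ (1 + δ) * y := by gcongr; linarith
  have hb : (1 + δ) * y ≤ 2 * ((1 - δ) * y) := by nlinarith
  have hval : 4 * δ / (1 - δ) = 2 * ((1 + δ) * y) / ((1 - δ) * y) - 2 := by
    have hδ : 1 - δ ≠ 0 := by linarith
    field_simp
    ring
  rw [hval]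
  refine ⟨fun lam hlam ⟨m, hm⟩ => ?_, fun lam hlam => ?_⟩
  · exact le_antisymm (sSup_contract_distance_le hlam ha hab hb hm)
      (le_sSup_contract_distance hlam ha hab hb)
  · exact le_sSup_contract_distance hlam ha hab hb
end

section
/- Let y > 0, 0 < δ ≤ 1/3, λ > 0, α ∈ [0,1), and let μ be a probability distribution supported on [(1−δ)y, (1+δ)y]. Let κ = ⌊log₂((1−δ)y/λ)⌋ and q_λ = μ( [(1−δ)y, λ·2^{κ+1}) ). Then the profit-version conditional value-at-risk of the random contract length L = ℓ_λ(T), where T ∼ μ, satisfies CVaR_α(L) = max{ λ·2^{κ−1}·(2(1−α) − q_λ)/(1−α), λ·2^{κ−1} }. -/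
open MeasureTheory

/-- The floor of the base-two logarithm is characterised by dyadic brackets. -/
theorem floor_logb_two_eq_iff {x : ℝ} (hx : 0 < x) (k : ℤ) :
    ⌊Real.logb 2 x⌋ = k ↔ (2:ℝ) ^ k ≤ x ∧ x < (2:ℝ) ^ (k + 1) := by
  rw [Int.floor_eq_iff, Real.le_logb_iff_rpow_le one_lt_two hx,
    Real.logb_lt_iff_lt_rpow one_lt_two hx, Real.rpow_intCast]
  have h : ((k : ℝ) + 1) = ((k + 1 : ℤ) : ℝ) := by push_cast; ring
  rw [h, Real.rpow_intCast]

/-- Between consecutive completion times the completed contract length is constant. -/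
theorem contractLen_eq {lam t : ℝ} (hlam : 0 < lam) (k : ℤ)
    (h₁ : lam * (2:ℝ) ^ k ≤ t) (h₂ : t < lam * (2:ℝ) ^ (k + 1)) :
    contractLen lam t = lam * (2:ℝ) ^ (k - 1) := by
  have ht : 0 < t := lt_of_lt_of_le (by positivity) h₁
  have h : ⌊Real.logb 2 (t / lam)⌋ = k := by
    rw [floor_logb_two_eq_iff (div_pos ht hlam), le_div_iff₀ hlam, div_lt_iff₀ hlam]
    constructor <;> linarith
  rw [contractLen, h]

/-- The expectation of a function that almost surely takes the value `a` on `S`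
and `b` off `S`. -/
theorem integral_eq_of_ae_two_valued {Ω : Type*} [MeasurableSpace Ω] (μ : Measure Ω)
    [IsProbabilityMeasure μ] {S : Set Ω} (hS : MeasurableSet S) (f : Ω → ℝ) (a b : ℝ)
    (h : ∀ᵐ x ∂μ, (x ∈ S → f x = a) ∧ (x ∉ S → f x = b)) :
    ∫ x, f x ∂μ = (μ S).toReal * a + (1 - (μ S).toReal) * b := by
  have hf : f =ᵐ[μ] fun x => S.indicator (fun _ => a - b) x + b := by
    filter_upwards [h] with x hx
    by_cases hxS : x ∈ S
    · simp [hxS, hx.1 hxS]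
    · simp [hxS, hx.2 hxS]
  rw [integral_congr_ae hf,
    integral_add ((integrable_const _).indicator hS) (integrable_const _),
    integral_indicator_const _ hS, integral_const]
  simp only [measureReal_def, measure_univ, ENNReal.toReal_one, smul_eq_mul]
  ring

/-- The profit-version conditional value-at-risk of a variable equal to `m` with
probability `q` and to `2 * m` with probability `1 - q`; the identity holds for every real `q`. -/
theorem iSup_cvar_two_valued {m q α : ℝ} (hm : 0 < m) (hα : α ∈ Set.Ico (0:ℝ) 1) :
    (⨆ t : ℝ, (t - (1 / (1 - α)) *
      (q * max (t - m) 0 + (1 - q) * max (t - 2 * m) 0))) =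
      max (m * (2 * (1 - α) - q) / (1 - α)) m := by
  obtain ⟨hα₀, hα₁⟩ := hα
  have hβ : 0 < 1 - α := by linarith
  have hc : 1 ≤ 1 / (1 - α) := by rw [le_div_iff₀ hβ]; linarith
  have hv : m * (2 * (1 - α) - q) / (1 - α) = 2 * m - 1 / (1 - α) * (q * m) := by
    field_simp
  rw [hv]
  generalize 1 / (1 - α) = c at hc
  have hle : ∀ t : ℝ, t - c * (q * max (t - m) 0 + (1 - q) * max (t - 2 * m) 0) ≤
      max (2 * m - c * (q * m)) m := by
    intro t
    rcases le_total t m with h₁ | h₁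
    · rw [max_eq_right (by linarith : t - m ≤ 0), max_eq_right (by linarith : t - 2 * m ≤ 0)]
      exact le_max_of_le_right (by linarith)
    rcases le_total t (2 * m) with h₂ | h₂
    · rw [max_eq_left (by linarith : 0 ≤ t - m), max_eq_right (by linarith : t - 2 * m ≤ 0)]
      rcases le_total (c * q) 1 with h | h
      · exact le_max_of_le_left (by nlinarith)
      · exact le_max_of_le_right (by nlinarith)
    · rw [max_eq_left (by linarith : 0 ≤ t - m), max_eq_left (by linarith : 0 ≤ t - 2 * m)]
      exact le_max_of_le_left (by nlinarith)
  have hbdd : BddAbove (Set.range fun t : ℝ =>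
      t - c * (q * max (t - m) 0 + (1 - q) * max (t - 2 * m) 0)) :=
    ⟨_, Set.forall_mem_range.2 hle⟩
  refine le_antisymm (ciSup_le hle) (max_le ?_ ?_)
  · refine le_trans (le_of_eq ?_) (le_ciSup hbdd (2 * m))
    rw [max_eq_left (by linarith : 0 ≤ 2 * m - m), max_eq_right (by linarith : 2 * m - 2 * m ≤ 0)]
    ring
  · refine le_trans (le_of_eq ?_) (le_ciSup hbdd m)
    rw [max_eq_right (by linarith : m - m ≤ 0), max_eq_right (by linarith : m - 2 * m ≤ 0)]
    ring

/-- For a distributional prediction `μ` supported on `[(1−δ)y, (1+δ)y]` with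
`0 < δ ≤ 1/3`, the profit-version conditional value-at-risk of the completed
contract length `ℓ_λ(T)`, `T ∼ μ`, equals
`max (λ·2^(κ−1)·(2(1−α) − q_λ)/(1−α)) (λ·2^(κ−1))`, where
`κ = ⌊log₂((1−δ)y/λ)⌋` and `q_λ = μ([(1−δ)y, λ·2^(κ+1)))`. -/
theorem contract_cvar (y δ lam α : ℝ) (μ : Measure ℝ) [IsProbabilityMeasure μ]
    (hy : 0 < y) (hδ1 : 0 < δ) (hδ2 : δ ≤ 1/3) (hlam : 0 < lam)
    (hα : α ∈ Set.Ico (0:ℝ) 1)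
    (hsupp : μ (Set.Icc ((1 - δ) * y) ((1 + δ) * y))ᶜ = 0) :
    (⨆ t : ℝ, (t - (1 / (1 - α)) * ∫ T, max (t - contractLen lam T) 0 ∂μ)) =
      max
        (lam * (2:ℝ) ^ (⌊Real.logb 2 ((1 - δ) * y / lam)⌋ - 1) *
          (2 * (1 - α) -
            (μ (Set.Ico ((1 - δ) * y)
              (lam * (2:ℝ) ^ (⌊Real.logb 2 ((1 - δ) * y / lam)⌋ + 1)))).toReal) /
          (1 - α))
        (lam * (2:ℝ) ^ (⌊Real.logb 2 ((1 - δ) * y / lam)⌋ - 1)) := by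
  have ha : 0 < (1 - δ) * y := mul_pos (by linarith) hy
  obtain ⟨hk₁, hk₂⟩ := (floor_logb_two_eq_iff (div_pos ha hlam) _).1
    (rfl : ⌊Real.logb 2 ((1 - δ) * y / lam)⌋ = _)
  rw [le_div_iff₀ hlam, mul_comm _ lam] at hk₁
  rw [div_lt_iff₀ hlam, mul_comm _ lam] at hk₂
  generalize ⌊Real.logb 2 ((1 - δ) * y / lam)⌋ = k at hk₁ hk₂ ⊢
  have hfar : (1 + δ) * y < lam * (2:ℝ) ^ (k + 1 + 1) := by
    rw [zpow_add_one₀ two_ne_zero (k + 1)]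
    nlinarith
  have hstep : lam * (2:ℝ) ^ (k + 1 - 1) = 2 * (lam * (2:ℝ) ^ (k - 1)) := by
    rw [show k + 1 - 1 = (k - 1) + 1 by ring, zpow_add_one₀ two_ne_zero]
    ring
  have hae : ∀ᵐ T ∂μ, T ∈ Set.Icc ((1 - δ) * y) ((1 + δ) * y) := hsupp
  have hint : ∀ t : ℝ, ∫ T, max (t - contractLen lam T) 0 ∂μ = _ := fun t =>
    integral_eq_of_ae_two_valued μ
      (measurableSet_Ico (a := (1 - δ) * y) (b := lam * (2:ℝ) ^ (k + 1))) _
      (max (t - lam * (2:ℝ) ^ (k - 1)) 0) (max (t - 2 * (lam * (2:ℝ) ^ (k - 1))) 0) <| by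
        filter_upwards [hae] with T hT
        refine ⟨fun h => ?_, fun h => ?_⟩
        · rw [contractLen_eq hlam k (hk₁.trans h.1) h.2]
        · have h' : lam * (2:ℝ) ^ (k + 1) ≤ T := not_lt.1 fun hlt => h ⟨hT.1, hlt⟩
          rw [contractLen_eq hlam (k + 1) h' (hT.2.trans_lt hfar), hstep]
  simp only [hint]
  exact iSup_cvar_two_valued (by positivity) hα
end

section
/- Let y ≥ 1 and δ ∈ (0, 1) satisfy (1−δ)y ≥ 1. Then: (i) for every T ∈ [(1−δ)y, (1+δ)y], one has ((1+δ)y − T)² / (4·y·δ·T) ≤ y − 1; and (ii) for every T ∈ [(1−δ)y, y], one has (T − 1)·(T − (1−δ)y)/(y·δ) ≤ y − 1. -/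
/-- In the game-theoretic analysis of the weighted maximum distance for one-max
search with the linear weight function, the adversary payoffs
`v4(T) = ((1+δ)y − T)²/(4yδT)` (for `T` in the prediction range) and
`v1(T) = (T−1)(T−(1−δ)y)/(yδ)` (for `T ≤ y`) are both dominated by
`v3 = y − 1`. -/
theorem oms_linear_weight_dominance (y δ : ℝ) (hy : 1 ≤ y)
    (hδ : δ ∈ Set.Ioo (0:ℝ) 1) (hlo : 1 ≤ (1 - δ) * y) :
    (∀ T ∈ Set.Icc ((1 - δ) * y) ((1 + δ) * y),
      ((1 + δ) * y - T) ^ 2 / (4 * y * δ * T) ≤ y - 1) ∧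
    (∀ T ∈ Set.Icc ((1 - δ) * y) y,
      (T - 1) * (T - (1 - δ) * y) / (y * δ) ≤ y - 1) := by
  have hd : 0 < y * δ := mul_pos (by linarith) hδ.1
  refine ⟨fun T ⟨hT₁, hT₂⟩ => ?_, fun T ⟨hT₁, hT₂⟩ => ?_⟩
  · have hT : 1 ≤ T := hlo.trans hT₁
    have hyd : y * δ ≤ y - 1 := by linarith
    rw [div_le_iff₀ (by nlinarith)]
    calc ((1 + δ) * y - T) ^ 2 ≤ (2 * (y * δ)) ^ 2 :=
          pow_le_pow_left₀ (by linarith) (by linarith) 2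
      _ = 4 * (y * δ) * (y * δ) := by ring
      _ ≤ 4 * (y * δ) * (y - 1) := by gcongr
      _ ≤ 4 * (y * δ) * (y - 1) * T :=
          le_mul_of_one_le_right (mul_nonneg (by linarith) (by linarith)) hT
      _ = (y - 1) * (4 * y * δ * T) := by ring
  · rw [div_le_iff₀ hd]
    exact mul_le_mul (by linarith) (by linarith) (by linarith) (by linarith)
end
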